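/- arXiv:0709.4035 — 8 statements merged into one kernel-verified Lean document; each statement's English description precedes it below -/
import Mathlib

section
/- Let L ≥ 2 be an integer and let σS2 > 0, σN2 > 0 and D with 0 < D < σS2 be reals such that λ := (σN2/L)·(1/D − 1/σS2) < 1. With ρ := σS2/(σS2 + σN2), the information-theoretic lower bound is strictly smaller than the uncoded power: (σS2/D − 1)/(L + (L2 − L)·ρ) < (σS2/D − 1) / (L2·σS2/(σS2 + σN2) − L·(σS2/D − 1)·σN2/(σS2 + σN2)). -/
/-- Theorem 5 (part): in a homogeneous Gaussian sensor network, the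
information-theoretic lower bound on the power is strictly smaller than the
uncoded (amplify-and-forward) power. -/
theorem lower_bound_lt_uncoded_power
    (L : ℕ) (hL : 2 ≤ L) (σS2 σN2 D : ℝ)
    (hσS : 0 < σS2) (hσN : 0 < σN2) (hD0 : 0 < D) (hDS : D < σS2)
    (hlam : (σN2 / L) * (1 / D - 1 / σS2) < 1) :
    (σS2 / D - 1) /
        ((L : ℝ) + ((L : ℝ) ^ 2 - L) * (σS2 / (σS2 + σN2))) <
      (σS2 / D - 1) /
        ((L : ℝ) ^ 2 * σS2 / (σS2 + σN2) - L * (σS2 / D - 1) * σN2 / (σS2 + σN2)) := by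
  have hL0 : (0 : ℝ) < L := by
    have : 0 < L := by omega
    exact_mod_cast this
  have ht : 0 < σS2 / D - 1 := by
    rw [sub_pos, lt_div_iff₀ hD0]; linarith
  have hlam' : (σS2 / D - 1) * σN2 < L * σS2 := by
    have h1 : (σN2 / L) * (1 / D - 1 / σS2) = ((σS2 / D - 1) * σN2) / (L * σS2) := by
      field_simp
    rw [h1, div_lt_one (by positivity)] at hlam
    exact hlam
  generalize σS2 / D - 1 = t at ht hlam'
  have hs : 0 < σS2 + σN2 := by positivity
  have e1 : (L : ℝ) ^ 2 * σS2 / (σS2 + σN2) - L * t * σN2 / (σS2 + σN2)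
      = L * (L * σS2 - t * σN2) / (σS2 + σN2) := by
    field_simp
  have e2 : (L : ℝ) + ((L : ℝ) ^ 2 - L) * (σS2 / (σS2 + σN2))
      = L * (L * σS2 + σN2) / (σS2 + σN2) := by
    field_simp
    ring
  rw [e1, e2]
  have hp : 0 < L * σS2 - t * σN2 := by linarith
  have hq : L * σS2 - t * σN2 < L * σS2 + σN2 := by
    have := mul_pos ht hσN
    linarith
  apply div_lt_div_of_pos_left ht (by positivity)
  gcongr
end

section
/- Fix reals σS2 > 0, σN2 > 0 and D with 0 < D < σS2, and set c := σN2·(1/D − 1/σS2). Then the sequence L ↦ L·P_J(L), where P_J(L) = (−1/L + (σS2/(L·D))·(1 − c/L)^(−L)) / (1 + (L − 1/L)·ρ̃_L) and ρ̃_L = (σS2/D − 1)/(L + σS2/D − 1), converges as L → ∞ (along natural numbers, eventually c/L < 1) to exp(c) − D/σS2. -/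
/-- Theorem 6 (joint-coding asymptotic): with c = σN2·(1/D − 1/σS2) and
ρ̃_L = (σS2/D − 1)/(L + σS2/D − 1), L·P_J(L) → exp(c) − D/σS2 as L → ∞. -/
theorem joint_power_asymptotic
    (σS2 σN2 D : ℝ) (hσS : 0 < σS2) (hσN : 0 < σN2) (hD0 : 0 < D) (hDS : D < σS2) :
    Filter.Tendsto
      (fun L : ℕ => (L : ℝ) *
        ((-(1 / L) + σS2 / (L * D) *
            (1 - σN2 * (1 / D - 1 / σS2) / L) ^ (-(L : ℤ))) /
          (1 + ((L : ℝ) - 1 / L) * ((σS2 / D - 1) / (L + σS2 / D - 1)))))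
      Filter.atTop
      (nhds (Real.exp (σN2 * (1 / D - 1 / σS2)) - D / σS2)) := by
  have hr : 1 < σS2 / D := (one_lt_div hD0).2 hDS
  have hDr : D / σS2 = 1 / (σS2 / D) := by field_simp
  have hrD : ∀ L : ℝ, σS2 / (L * D) = (σS2 / D) * (1 / L) := by
    intro L
    rw [mul_comm L D, ← div_div]
    ring
  simp only [hrD]
  rw [hDr]
  generalize σS2 / D = r at *
  generalize σN2 * (1 / D - 1 / σS2) = c at *
  have hx : Filter.Tendsto (fun L : ℕ => (1 : ℝ) / (L : ℝ)) Filter.atTop (nhds 0) :=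
    tendsto_one_div_atTop_nhds_zero_nat
  have he : Filter.Tendsto (fun L : ℕ => ((1 + (-c) / (L : ℝ)) ^ L)⁻¹) Filter.atTop
      (nhds (Real.exp (-c))⁻¹) :=
    (Real.tendsto_one_add_div_pow_exp (-c)).inv₀ (Real.exp_pos _).ne'
  rw [Real.exp_neg, inv_inv] at he
  have hn := (he.const_mul r).const_add (-1)
  have hd : Filter.Tendsto (fun L : ℕ => 1 + (1 - (1 / (L : ℝ)) ^ 2) * ((r - 1) /
      (1 + (r - 1) * (1 / (L : ℝ))))) Filter.atTop
      (nhds (1 + (1 - (0 : ℝ) ^ 2) * ((r - 1) / (1 + (r - 1) * 0)))) := by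
    refine (((hx.pow 2).const_sub 1).mul (Filter.Tendsto.div tendsto_const_nhds
      ((hx.const_mul (r - 1)).const_add 1) ?_)).const_add 1
    norm_num
  have hq := hn.div hd (by norm_num; linarith)
  have hlim : (-1 + r * Real.exp c) / (1 + (1 - (0 : ℝ) ^ 2) * ((r - 1) / (1 + (r - 1) * 0)))
      = Real.exp c - 1 / r := by
    have : r ≠ 0 := by linarith
    have h2 : 1 + (1 - (0 : ℝ) ^ 2) * ((r - 1) / (1 + (r - 1) * 0)) = r := by norm_num
    rw [h2]
    field_simp
    ring
  rw [hlim] at hq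
  refine hq.congr' ?_
  filter_upwards [Filter.eventually_gt_atTop 0] with L hL
  have hL' : (0 : ℝ) < L := by exact_mod_cast hL
  have hpos : (L : ℝ) + r - 1 ≠ 0 := by linarith
  have e1 : (1 - (1 / (L : ℝ)) ^ 2) * ((r - 1) / (1 + (r - 1) * (1 / (L : ℝ))))
      = ((L : ℝ) - 1 / L) * ((r - 1) / (L + r - 1)) := by
    have h3 : 1 + (r - 1) * (1 / (L : ℝ)) = (L + r - 1) / L := by
      field_simp
      ring
    rw [h3]
    field_simp
  have e2 : (1 - c / (L : ℝ)) ^ (-(L : ℤ)) = ((1 + (-c) / (L : ℝ)) ^ L)⁻¹ := by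
    rw [zpow_neg, zpow_natCast, neg_div, ← sub_eq_add_neg]
  simp only [Pi.div_apply]
  rw [e1, e2, ← mul_div_assoc]
  congr 1
  field_simp
end

section
/- Fix reals σS2 > 0, σN2 > 0 and D with 0 < D < σS2 and set ρ := σS2/(σS2 + σN2). Then the sequence L ↦ L2·P_LoB(L), where P_LoB(L) = (σS2/D − 1)/(L + (L2 − L)·ρ), converges as L → ∞ to (1/D − 1/σS2)·(σS2 + σN2); in particular it has the same limit as L2·P_A(L) where P_A(L) = (σS2/D − 1)/(L2·σS2/(σS2 + σN2) − L·(σS2/D − 1)·σN2/(σS2 + σN2)). -/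
theorem aux_quadratic_limit (c r k : ℝ) (hr : r ≠ 0) :
    Filter.Tendsto (fun L : ℕ => (L : ℝ) ^ 2 * (c / ((L : ℝ) ^ 2 * r + (L : ℝ) * k)))
      Filter.atTop (nhds (c / r)) := by
  have h1 : Filter.Tendsto (fun L : ℕ => c / (r + k * (L : ℝ)⁻¹)) Filter.atTop
      (nhds (c / (r + k * 0))) := by
    refine Filter.Tendsto.div tendsto_const_nhds ?_ (by simpa using hr)
    exact tendsto_const_nhds.add (tendsto_const_nhds.mul tendsto_inv_atTop_nhds_zero_nat)
  rw [mul_zero, add_zero] at h1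
  refine h1.congr' ?_
  filter_upwards [Filter.eventually_gt_atTop 0] with L hL
  have hL' : (L : ℝ) ≠ 0 := by exact_mod_cast hL.ne'
  have e : (L : ℝ) ^ 2 * r + (L : ℝ) * k = (L : ℝ) ^ 2 * (r + k * (L : ℝ)⁻¹) := by
    field_simp
  rw [e, ← mul_div_assoc, mul_div_mul_left _ _ (pow_ne_zero 2 hL')]

/-- Theorem 6 (lower-bound asymptotic): with ρ = σS2/(σS2 + σN2),
L²·P_LoB(L) → (1/D − 1/σS2)·(σS2 + σN2) as L → ∞; in particular it has the
same limit as L²·P_A(L), establishing the asymptotic optimality of the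
uncoded scheme. -/
theorem lower_bound_asymptotic
    (σS2 σN2 D : ℝ) (hσS : 0 < σS2) (hσN : 0 < σN2) (hD0 : 0 < D) (hDS : D < σS2) :
    Filter.Tendsto
      (fun L : ℕ => (L : ℝ) ^ 2 *
        ((σS2 / D - 1) /
          ((L : ℝ) + ((L : ℝ) ^ 2 - L) * (σS2 / (σS2 + σN2)))))
      Filter.atTop
      (nhds ((1 / D - 1 / σS2) * (σS2 + σN2))) ∧
    Filter.Tendsto
      (fun L : ℕ => (L : ℝ) ^ 2 *
        ((σS2 / D - 1) /
          ((L : ℝ) ^ 2 * σS2 / (σS2 + σN2) - (L : ℝ) * (σS2 / D - 1) * σN2 / (σS2 + σN2))))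
      Filter.atTop
      (nhds ((1 / D - 1 / σS2) * (σS2 + σN2))) := by
  have hs : σS2 + σN2 ≠ 0 := by positivity
  have hr : σS2 / (σS2 + σN2) ≠ 0 := by positivity
  have hlim : (1 / D - 1 / σS2) * (σS2 + σN2) = (σS2 / D - 1) / (σS2 / (σS2 + σN2)) := by
    field_simp
  rw [hlim]
  constructor
  · refine (aux_quadratic_limit _ _ (1 - σS2 / (σS2 + σN2)) hr).congr fun L => ?_
    congr 2
    ring
  · refine (aux_quadratic_limit _ _ (-((σS2 / D - 1) * σN2 / (σS2 + σN2))) hr).congr fun L => ?_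
    congr 2
    ring
end

section
/- Fix an integer L ≥ 2, a real σS2 > 0, a real λ* with λ* < 1, and a function D : ℝ → ℝ with 0 < D(t) < σS2 for all sufficiently small t > 0. Assume that as t → 0+ one has D(t) → 0 and λ(t) := (t/L)·(1/D(t) − 1/σS2) → λ*. Then the ratio P_A(t)/(σS2/D(t)), where P_A(t) = (σS2/D(t) − 1) / (L2·σS2/(σS2 + t) − L·(σS2/D(t) − 1)·t/(σS2 + t)), converges as t → 0+ to 1/(L2·(1 − λ*)). -/
open Filter

/-- Theorem 7 (uncoded case): as the measurement-noise variance t → 0⁺, with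
D(t) → 0 and λ(t) = (t/L)·(1/D(t) − 1/σS2) → λ*, the ratio P_A(t)/(σS2/D(t))
converges to 1/(L²·(1 − λ*)). -/
theorem uncoded_asymptotic_ratio
    (L : ℕ) (hL : 2 ≤ L) (σS2 lamStar : ℝ) (hσS : 0 < σS2) (hls : lamStar < 1)
    (D : ℝ → ℝ)
    (hD : ∀ᶠ t in nhdsWithin 0 (Set.Ioi 0), 0 < D t ∧ D t < σS2)
    (hD0 : Tendsto D (nhdsWithin 0 (Set.Ioi 0)) (nhds 0))
    (hlam : Tendsto (fun t : ℝ => (t / L) * (1 / D t - 1 / σS2))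
      (nhdsWithin 0 (Set.Ioi 0)) (nhds lamStar)) :
    Tendsto
      (fun t : ℝ =>
        ((σS2 / D t - 1) /
            ((L : ℝ) ^ 2 * σS2 / (σS2 + t) - (L : ℝ) * (σS2 / D t - 1) * t / (σS2 + t))) /
          (σS2 / D t))
      (nhdsWithin 0 (Set.Ioi 0))
      (nhds (1 / ((L : ℝ) ^ 2 * (1 - lamStar)))) := by
  have hL0 : (L : ℝ) ≠ 0 := by
    have : L ≠ 0 := by omega
    exact_mod_cast this
  have hσ : σS2 ≠ 0 := hσS.ne'
  have ht : Tendsto (fun t : ℝ => t) (nhdsWithin 0 (Set.Ioi 0)) (nhds 0) :=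
    tendsto_nhdsWithin_of_tendsto_nhds tendsto_id
  have hnum : Tendsto (fun t : ℝ => 1 - D t / σS2) (nhdsWithin 0 (Set.Ioi 0))
      (nhds (1 - 0 / σS2)) := tendsto_const_nhds.sub (hD0.div_const _)
  have hfac : Tendsto (fun t : ℝ => σS2 / (σS2 + t)) (nhdsWithin 0 (Set.Ioi 0))
      (nhds (σS2 / (σS2 + 0))) :=
    tendsto_const_nhds.div (tendsto_const_nhds.add ht) (by simpa using hσ)
  have hden := (hfac.const_mul ((L : ℝ) ^ 2)).mul
    ((tendsto_const_nhds (x := (1 : ℝ))).sub hlam)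
  have h1 : (1 - lamStar) ≠ 0 := (sub_pos.mpr hls).ne'
  have hmain := hnum.div hden (by
    rw [add_zero, div_self hσ, mul_one]
    exact mul_ne_zero (pow_ne_zero 2 hL0) h1)
  rw [add_zero, div_self hσ, mul_one, zero_div, sub_zero] at hmain
  refine hmain.congr' ?_
  filter_upwards [hD, self_mem_nhdsWithin] with t hDt htp
  have hDne : D t ≠ 0 := hDt.1.ne'
  have htp' : 0 < t := htp
  have hst : σS2 + t ≠ 0 := by positivity
  have e1 : (L : ℝ) ^ 2 * σS2 / (σS2 + t) - (L : ℝ) * (σS2 / D t - 1) * t / (σS2 + t)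
      = (L : ℝ) ^ 2 * (σS2 / (σS2 + t)) * (1 - (t / L) * (1 / D t - 1 / σS2)) := by
    field_simp
  have e2 : 1 - D t / σS2 = (σS2 / D t - 1) / (σS2 / D t) := by
    field_simp
  simp only [Pi.div_apply]
  rw [e1, e2, div_right_comm]
end

section
/- Fix an integer L ≥ 2, a real σS2 > 0, a real λ* with λ* < 1, and a function D : ℝ → ℝ with 0 < D(t) < σS2 for all sufficiently small t > 0. Assume that as t → 0+ one has D(t) → 0 and λ(t) := (t/L)·(1/D(t) − 1/σS2) → λ*. Then the SNR exponent of the separate-coding scheme equals 1: with P_S(t) = −1/L + (σS2/(L·D(t)))·(1 − λ(t))^(−L), one has −ln(D(t))/ln(P_S(t)) → 1 as t → 0+. -/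
open Filter

/-- SNR exponent of the separate-coding scheme equals 1: as the
measurement-noise variance t → 0⁺, with D(t) → 0 and
λ(t) = (t/L)·(1/D(t) − 1/σS2) → λ* < 1, one has −ln D(t)/ln P_S(t) → 1. -/
theorem separate_snr_exponent_one
    (L : ℕ) (hL : 2 ≤ L) (σS2 lamStar : ℝ) (hσS : 0 < σS2) (hls : lamStar < 1)
    (D : ℝ → ℝ)
    (hD : ∀ᶠ t in nhdsWithin 0 (Set.Ioi 0), 0 < D t ∧ D t < σS2)
    (hD0 : Tendsto D (nhdsWithin 0 (Set.Ioi 0)) (nhds 0))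
    (hlam : Tendsto (fun t : ℝ => (t / L) * (1 / D t - 1 / σS2))
      (nhdsWithin 0 (Set.Ioi 0)) (nhds lamStar)) :
    Tendsto
      (fun t : ℝ =>
        -Real.log (D t) /
          Real.log (-(1 / (L : ℝ)) + σS2 / (L * D t) *
            (1 - (t / L) * (1 / D t - 1 / σS2)) ^ (-(L : ℤ))))
      (nhdsWithin 0 (Set.Ioi 0)) (nhds 1) := by
  have hL0 : (0 : ℝ) < L := by
    have : 0 < L := by omega
    exact_mod_cast this
  have h1 : Tendsto (fun t : ℝ => 1 - (t / L) * (1 / D t - 1 / σS2))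
      (nhdsWithin 0 (Set.Ioi 0)) (nhds (1 - lamStar)) := tendsto_const_nhds.sub hlam
  have hpos : 0 < 1 - lamStar := by linarith
  have h2 := h1.zpow₀ (-(L : ℤ)) (Or.inl hpos.ne')
  have hG : Tendsto (fun t : ℝ => -(1 / (L : ℝ)) * D t + σS2 / L *
      (1 - (t / L) * (1 / D t - 1 / σS2)) ^ (-(L : ℤ)))
      (nhdsWithin 0 (Set.Ioi 0))
      (nhds (-(1 / (L : ℝ)) * 0 + σS2 / L * (1 - lamStar) ^ (-(L : ℤ)))) :=
    (hD0.const_mul _).add (h2.const_mul _)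
  have hc : 0 < -(1 / (L : ℝ)) * 0 + σS2 / L * (1 - lamStar) ^ (-(L : ℤ)) := by
    have := zpow_pos hpos (-(L : ℤ))
    rw [mul_zero, zero_add]
    positivity
  have hlogG := hG.log hc.ne'
  have hDw : Tendsto D (nhdsWithin 0 (Set.Ioi 0)) (nhdsWithin 0 (Set.Ioi 0)) :=
    tendsto_nhdsWithin_iff.2 ⟨hD0, hD.mono fun t h => h.1⟩
  have hu : Tendsto (fun t => -Real.log (D t)) (nhdsWithin 0 (Set.Ioi 0)) atTop :=
    tendsto_neg_atBot_atTop.comp (Real.tendsto_log_nhdsGT_zero.comp hDw)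
  have hq := ((hlogG.div_atTop hu).add_const 1).inv₀ (by norm_num)
  rw [zero_add, inv_one] at hq
  refine hq.congr' ?_
  filter_upwards [hD, hG.eventually (lt_mem_nhds hc), hu.eventually_gt_atTop 0] with t hDt hGt hut
  have hP : -(1 / (L : ℝ)) + σS2 / (L * D t) *
            (1 - (t / L) * (1 / D t - 1 / σS2)) ^ (-(L : ℤ)) =
      (-(1 / (L : ℝ)) * D t + σS2 / L *
      (1 - (t / L) * (1 / D t - 1 / σS2)) ^ (-(L : ℤ))) / D t := by
    generalize (1 - (t / L) * (1 / D t - 1 / σS2)) ^ (-(L : ℤ)) = z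
    have := hDt.1.ne'
    field_simp
  rw [hP, Real.log_div hGt.ne' hDt.1.ne', div_add_one hut.ne', inv_div, ← sub_eq_add_neg]
end

section
/- Let L be a positive integer and R : Fin L → ℝ with R i ≥ 0 for all i. Define the set function f on subsets (Finsets) S of Fin L by f(S) = (∏_{i ∈ S} 2^(2·R i)) − 1. Then: (1) f(∅) = 0; (2) f is monotone: S ⊆ T implies f(S) ≤ f(T); (3) f is supermodular: f(S) + f(T) ≤ f(S ∪ T) + f(S ∩ T) for all S, T. -/
/-- The set function f(S) = ∏_{i∈S} 2^{2Rᵢ} − 1 (with Rᵢ ≥ 0) is normalized,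
monotone and supermodular: exactly the conditions making the feasible power
region a contra-polymatroid (proof of Theorem 3). -/
theorem rate_set_function_contra_polymatroid
    (L : ℕ) (hL : 0 < L) (R : Fin L → ℝ) (hR : ∀ i, 0 ≤ R i)
    (f : Finset (Fin L) → ℝ)
    (hf : ∀ S : Finset (Fin L), f S = (∏ i ∈ S, (2 : ℝ) ^ (2 * R i)) - 1) :
    f ∅ = 0 ∧
      (∀ S T : Finset (Fin L), S ⊆ T → f S ≤ f T) ∧
      (∀ S T : Finset (Fin L), f S + f T ≤ f (S ∪ T) + f (S ∩ T)) := by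
  have h1 : ∀ i, (1 : ℝ) ≤ (2 : ℝ) ^ (2 * R i) := fun i =>
    Real.one_le_rpow (by norm_num) (by linarith [hR i])
  have hpos : ∀ S : Finset (Fin L), 0 < ∏ i ∈ S, (2 : ℝ) ^ (2 * R i) := fun S =>
    Finset.prod_pos fun i _ => lt_of_lt_of_le one_pos (h1 i)
  have hone : ∀ S : Finset (Fin L), 1 ≤ ∏ i ∈ S, (2 : ℝ) ^ (2 * R i) := fun S => by
    have h := Finset.prod_le_prod (s := S) (f := fun _ => (1 : ℝ))
      (g := fun i => (2 : ℝ) ^ (2 * R i)) (fun _ _ => zero_le_one) (fun i _ => h1 i)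
    simpa using h
  have hmono : ∀ S T : Finset (Fin L), S ⊆ T →
      ∏ i ∈ S, (2 : ℝ) ^ (2 * R i) ≤ ∏ i ∈ T, (2 : ℝ) ^ (2 * R i) := fun S T hST => by
    rw [← Finset.prod_sdiff hST]
    exact le_mul_of_one_le_left (hpos S).le (hone _)
  refine ⟨by simp [hf], fun S T hST => ?_, fun S T => ?_⟩
  · rw [hf, hf]
    linarith [hmono S T hST]
  · rw [hf, hf, hf, hf]
    have hm := Finset.prod_union_inter (s₁ := S) (s₂ := T) (f := fun i => (2 : ℝ) ^ (2 * R i))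
    have hs := hmono _ _ (Finset.inter_subset_left (s₁ := S) (s₂ := T))
    have ht := hmono _ _ (Finset.inter_subset_right (s₁ := S) (s₂ := T))
    have hc := hpos (S ∩ T)
    have key := mul_nonneg (sub_nonneg.2 hs) (sub_nonneg.2 ht)
    have : 0 ≤ (∏ i ∈ S ∩ T, (2 : ℝ) ^ (2 * R i)) *
        ((∏ i ∈ S ∪ T, (2 : ℝ) ^ (2 * R i)) + (∏ i ∈ S ∩ T, (2 : ℝ) ^ (2 * R i))
          - (∏ i ∈ S, (2 : ℝ) ^ (2 * R i)) - (∏ i ∈ T, (2 : ℝ) ^ (2 * R i))) := by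
      linarith
    linarith [nonneg_of_mul_nonneg_right this hc]
end

section
/- Let L beEight a positive integer and a : Fin L → ℝ with a j ≥ 1 for all j. Define X_i = (∏_{j ≤ i} a j) − (∏_{j < i} a j) for each i (products over indices j with j ≤ i, respectively j < i, in the natural order of Fin L). Then for every subset (Finset) S of Fin L, ∑_{i ∈ S} X_i ≥ (∏_{i ∈ S} a i) − 1. -/
/-- The vertex point X_i = ∏_{j≤i} a_j − ∏_{j<i} a_j (with a_j ≥ 1) of the
contra-polymatroid satisfies all the defining inequalities
∑_{i∈S} X_i ≥ ∏_{i∈S} a_i − 1 (proof of Theorem 3, equation (sep power vector)). -/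
theorem vertex_point_feasible
    (L : ℕ) (hL : 0 < L) (a : Fin L → ℝ) (ha : ∀ j, 1 ≤ a j)
    (X : Fin L → ℝ)
    (hX : ∀ i, X i = (∏ j ∈ Finset.Iic i, a j) - ∏ j ∈ Finset.Iio i, a j) :
    ∀ S : Finset (Fin L), (∏ i ∈ S, a i) - 1 ≤ ∑ i ∈ S, X i := by
  intro S
  induction S using Finset.induction_on_max with
  | empty => simp
  | insert m T hT ih =>
    have hm : m ∉ T := fun h => lt_irrefl _ (hT m h)
    have hsub : T ⊆ Finset.Iio m := fun x hx => Finset.mem_Iio.2 (hT x hx)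
    have h1 : ∏ j ∈ T, a j ≤ ∏ j ∈ Finset.Iio m, a j :=
      Finset.prod_le_prod_of_subset_of_one_le hsub
        (fun i _ => zero_le_one.trans (ha i)) (fun i _ _ => ha i)
    have h2 : ∏ j ∈ Finset.Iic m, a j = a m * ∏ j ∈ Finset.Iio m, a j := by
      rw [← Finset.Iio_insert, Finset.prod_insert (by simp)]
    rw [Finset.prod_insert hm, Finset.sum_insert hm, hX m, h2]
    nlinarith [mul_le_mul_of_nonneg_left h1 (sub_nonneg.2 (ha m))]
end

section
/- Let g1, g2, σW2 > 0, let ρ̃ ∈ ℝ with ρ̃² < 1, and let Z1, Z2 ≥ 1 be reals. Define b_i = (Z_i − 1)·σW2/((1 − ρ̃²)·g_i) for i = 1, 2 and b_3 = σW2·(Z_1·Z_2/(1 − ρ̃²) − 1). Then g1·b1 + g2·b2 + 2·ρ̃·√(g1·b1·g2·b2) − b_3 = −(σW2/(1 − ρ̃²))·(√((Z_1 − 1)·(Z_2 − 1)) − ρ̃)². In particular this quantity is ≤ 0. -/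
/-- Proof of Theorem 4: the corner point (b₁, b₂) of the individual power
constraints lies inside the ellipse given by the sum-rate constraint:
g₁b₁ + g₂b₂ + 2ρ̃√(g₁b₁g₂b₂) − b₃ = −(σW2/(1−ρ̃²))(√((Z₁−1)(Z₂−1)) − ρ̃)² ≤ 0. -/
theorem corner_point_inside_ellipse
    (g1 g2 σW2 ρ Z1 Z2 b1 b2 b3 : ℝ)
    (hg1 : 0 < g1) (hg2 : 0 < g2) (hσW : 0 < σW2) (hρ : ρ ^ 2 < 1)
    (hZ1 : 1 ≤ Z1) (hZ2 : 1 ≤ Z2)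
    (hb1 : b1 = (Z1 - 1) * σW2 / ((1 - ρ ^ 2) * g1))
    (hb2 : b2 = (Z2 - 1) * σW2 / ((1 - ρ ^ 2) * g2))
    (hb3 : b3 = σW2 * (Z1 * Z2 / (1 - ρ ^ 2) - 1)) :
    g1 * b1 + g2 * b2 + 2 * ρ * Real.sqrt (g1 * b1 * (g2 * b2)) - b3 =
        -(σW2 / (1 - ρ ^ 2)) * (Real.sqrt ((Z1 - 1) * (Z2 - 1)) - ρ) ^ 2 ∧
      g1 * b1 + g2 * b2 + 2 * ρ * Real.sqrt (g1 * b1 * (g2 * b2)) - b3 ≤ 0 := by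
  have hd : 0 < 1 - ρ ^ 2 := by linarith
  obtain ⟨c, hc⟩ : ∃ c, c = σW2 / (1 - ρ ^ 2) := ⟨_, rfl⟩
  have hc0 : 0 < c := by rw [hc]; positivity
  have hσ : σW2 = c * (1 - ρ ^ 2) := by rw [hc]; field_simp
  have h1 : g1 * b1 = c * (Z1 - 1) := by rw [hb1, hc]; field_simp
  have h2 : g2 * b2 = c * (Z2 - 1) := by rw [hb2, hc]; field_simp
  have h3 : b3 = c * (Z1 * Z2) - c * (1 - ρ ^ 2) := by rw [hb3, hσ]; field_simp
  have hn : 0 ≤ (Z1 - 1) * (Z2 - 1) := mul_nonneg (by linarith) (by linarith)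
  have hs : Real.sqrt (c * (Z1 - 1) * (c * (Z2 - 1))) = c * Real.sqrt ((Z1 - 1) * (Z2 - 1)) := by
    rw [show c * (Z1 - 1) * (c * (Z2 - 1)) = c ^ 2 * ((Z1 - 1) * (Z2 - 1)) by ring,
      Real.sqrt_mul (by positivity), Real.sqrt_sq hc0.le]
  have hq := Real.sq_sqrt hn
  have key : g1 * b1 + g2 * b2 + 2 * ρ * Real.sqrt (g1 * b1 * (g2 * b2)) - b3 =
      -(σW2 / (1 - ρ ^ 2)) * (Real.sqrt ((Z1 - 1) * (Z2 - 1)) - ρ) ^ 2 := by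
    rw [h1, h2, hs, h3, ← hc]
    linear_combination c * hq
  refine ⟨key, ?_⟩
  rw [key, ← hc, neg_mul]
  exact neg_nonpos.mpr (by positivity)
end
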